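/- Consider an n-player normal-form game with strictly positive utilities. Let (α_k) be a sequence of reals with α_k → ∞, and for each k let p^k be a generalized equilibrium at selfishness level α_k. If the profiles p^k converge pointwise to a strategy profile p* (i.e., p^k_i(x_i) → p*_i(x_i) for every i and x_i), then p* is a Nash equilibrium. In particular, every accumulation point of generalized equilibria as the selfishness level tends to infinity is a Nash equilibrium. -/

import Mathlib

open Finset Filter

/-- `p` is a (mixed) strategy profile: each `p i` is a probability distribution on `S i`. -/
def IsProfile {n : ℕ} {S : Fin n → Type*} [∀ i, Fintype (S i)]
    (p : ∀ i, S i → ℝ) : Prop :=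
  (∀ i a, 0 ≤ p i a) ∧ ∀ i, ∑ a, p i a = 1

/-- The action payoff `u_i(a, p_{-i})` of action `a` of player `i` against profile `p`. -/
noncomputable def actionPayoff {n : ℕ} {S : Fin n → Type*} [∀ i, Fintype (S i)]
    [∀ i, DecidableEq (S i)]
    (u : ∀ _ : Fin n, (∀ j, S j) → ℝ) (p : ∀ i, S i → ℝ) (i : Fin n) (a : S i) : ℝ :=
  ∑ x : ∀ j, S j, if x i = a then u i x * ∏ j ∈ univ.erase i, p j (x j) else 0

/-- `p` is a Nash equilibrium: no player can improve by unilaterally changing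
to any mixed strategy `q`. -/
def IsNash {n : ℕ} {S : Fin n → Type*} [∀ i, Fintype (S i)] [∀ i, DecidableEq (S i)]
    (u : ∀ _ : Fin n, (∀ j, S j) → ℝ) (p : ∀ i, S i → ℝ) : Prop :=
  IsProfile p ∧ ∀ i, ∀ q : S i → ℝ, (∀ a, 0 ≤ q a) → ∑ a, q a = 1 →
    ∑ a, q a * actionPayoff u p i a ≤ ∑ a, p i a * actionPayoff u p i a

/-- `p` is a generalized equilibrium at selfishness level `α`. -/
def IsGenEquilibrium {n : ℕ} {S : Fin n → Type*} [∀ i, Fintype (S i)]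
    [∀ i, DecidableEq (S i)]
    (u : ∀ _ : Fin n, (∀ j, S j) → ℝ) (α : ℝ) (p : ∀ i, S i → ℝ) : Prop :=
  IsProfile p ∧ ∀ i (a : S i),
    p i a = actionPayoff u p i a ^ α / ∑ b, actionPayoff u p i b ^ α

/-- Action payoffs against a profile are positive when utilities are. -/
theorem IsProfile.actionPayoff_pos {n : ℕ} {S : Fin n → Type*} [∀ i, Fintype (S i)]
    [∀ i, DecidableEq (S i)] {u : ∀ _ : Fin n, (∀ j, S j) → ℝ} (hu : ∀ i x, 0 < u i x)
    {p : ∀ i, S i → ℝ} (hp : IsProfile p) (i : Fin n) (a : S i) :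
    0 < actionPayoff u p i a := by
  have h_supp : ∀ j, ∃ b, 0 < p j b := by
    intro j
    by_contra! h
    have := Finset.sum_nonpos (fun b (_ : b ∈ univ) => h b)
    linarith [hp.2 j]
  choose x hx using h_supp
  unfold actionPayoff
  refine Finset.sum_pos' (fun y _ => ?_) ⟨Function.update x i a, mem_univ _, ?_⟩
  · split_ifs
    · exact mul_nonneg (hu i y).le (Finset.prod_nonneg fun j _ => hp.1 j _)
    · exact le_rfl
  · rw [if_pos (Function.update_self i a x)]
    refine mul_pos (hu i _) (Finset.prod_pos fun j hj => ?_)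
    rw [Function.update_of_ne (Finset.ne_of_mem_erase hj)]
    exact hx j

/-- Action payoffs depend continuously on the profile. -/
theorem tendsto_actionPayoff {ι : Type*} {l : Filter ι} {n : ℕ} {S : Fin n → Type*}
    [∀ i, Fintype (S i)] [∀ i, DecidableEq (S i)] (u : ∀ _ : Fin n, (∀ j, S j) → ℝ)
    {p : ι → ∀ i, S i → ℝ} {q : ∀ i, S i → ℝ}
    (h : ∀ i (a : S i), Tendsto (fun k => p k i a) l (nhds (q i a))) (i : Fin n) (a : S i) :
    Tendsto (fun k => actionPayoff u (p k) i a) l (nhds (actionPayoff u q i a)) := by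
  unfold actionPayoff
  refine tendsto_finsetSum _ fun x _ => ?_
  split_ifs
  · exact (tendsto_finsetProd _ fun j _ => h j (x j)).const_mul _
  · exact tendsto_const_nhds

/-- If `f` and `g` converge to positive limits, the first smaller, then `(f / g) ^ α` tends to `0`
as `α` tends to infinity. -/
theorem tendsto_div_rpow_zero {ι : Type*} {l : Filter ι} {f g α : ι → ℝ} {x y : ℝ}
    (hf : Tendsto f l (nhds x)) (hg : Tendsto g l (nhds y)) (hα : Tendsto α l atTop)
    (hx : 0 < x) (hxy : x < y) :
    Tendsto (fun k => (f k / g k) ^ α k) l (nhds 0) := by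
  have hy : 0 < y := hx.trans hxy
  have h_ratio : Tendsto (fun k => f k / g k) l (nhds (x / y)) := hf.div hg hy.ne'
  obtain ⟨c, hxc, hc⟩ := exists_between ((div_lt_one hy).2 hxy)
  have hc0 : 0 < c := (div_pos hx hy).trans hxc
  have h_pow : Tendsto (fun k => c ^ α k) l (nhds 0) :=
    (tendsto_rpow_atTop_of_base_lt_one c (by linarith) hc).comp hα
  have h_pos := h_ratio.eventually_const_lt (div_pos hx hy)
  refine tendsto_of_tendsto_of_tendsto_of_le_of_le'
    tendsto_const_nhds h_pow ?_ ?_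
  · filter_upwards [h_pos] with k hk using Real.rpow_nonneg hk.le _
  · filter_upwards [h_pos, h_ratio.eventually_lt_const hxc, hα.eventually_ge_atTop 0]
      with k hk hkc hk0
    exact Real.rpow_le_rpow hk.le hkc.le hk0

/-- In a generalized equilibrium, the probability of an action is bounded by a power of the
ratio of its payoff to the payoff of any other action. -/
theorem IsGenEquilibrium.le_div_rpow {n : ℕ} {S : Fin n → Type*} [∀ i, Fintype (S i)]
    [∀ i, DecidableEq (S i)] {u : ∀ _ : Fin n, (∀ j, S j) → ℝ} (hu : ∀ i x, 0 < u i x)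
    {α : ℝ} {p : ∀ i, S i → ℝ} (hp : IsGenEquilibrium u α p) (i : Fin n) (a b : S i) :
    p i a ≤ (actionPayoff u p i a / actionPayoff u p i b) ^ α := by
  have h_pos := hp.1.actionPayoff_pos hu i
  rw [hp.2 i a, Real.div_rpow (h_pos a).le (h_pos b).le]
  exact div_le_div_of_nonneg_left (Real.rpow_nonneg (h_pos a).le _)
    (Real.rpow_pos_of_pos (h_pos b) _)
    (Finset.single_le_sum (f := fun b => actionPayoff u p i b ^ α)
      (fun c _ => Real.rpow_nonneg (h_pos c).le _) (mem_univ b))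

/-- A profile supported on best responses is a Nash equilibrium. -/
theorem IsProfile.isNash_of_support {n : ℕ} {S : Fin n → Type*} [∀ i, Fintype (S i)]
    [∀ i, Nonempty (S i)] [∀ i, DecidableEq (S i)] {u : ∀ _ : Fin n, (∀ j, S j) → ℝ}
    {p : ∀ i, S i → ℝ} (hp : IsProfile p)
    (h : ∀ i (a b : S i), actionPayoff u p i a < actionPayoff u p i b → p i a = 0) :
    IsNash u p := by
  refine ⟨hp, fun i q hq hq1 => ?_⟩
  obtain ⟨b, hb⟩ := Finite.exists_max (actionPayoff u p i)
  calc ∑ a, q a * actionPayoff u p i a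
      ≤ ∑ a, q a * actionPayoff u p i b :=
        Finset.sum_le_sum fun a _ => mul_le_mul_of_nonneg_left (hb a) (hq a)
    _ = ∑ a, p i a * actionPayoff u p i b := by
        rw [← Finset.sum_mul, ← Finset.sum_mul, hq1, hp.2 i]
    _ = ∑ a, p i a * actionPayoff u p i a := by
        refine Finset.sum_congr rfl fun a _ => ?_
        rcases (hb a).lt_or_eq with hlt | heq
        · rw [h i a b hlt, zero_mul, zero_mul]
        · rw [heq]

/-- Any pointwise limit of generalized equilibria whose selfishness levels tend to
infinity is a Nash equilibrium. -/
theorem limit_of_genEquilibria_isNash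
    {n : ℕ} {S : Fin n → Type*} [∀ i, Fintype (S i)] [∀ i, Nonempty (S i)]
    [∀ i, DecidableEq (S i)]
    (u : ∀ _ : Fin n, (∀ j, S j) → ℝ) (hu : ∀ i x, 0 < u i x)
    (α : ℕ → ℝ) (hα : Tendsto α atTop atTop)
    (p : ℕ → ∀ i, S i → ℝ) (hp : ∀ k, IsGenEquilibrium u (α k) (p k))
    (pstar : ∀ i, S i → ℝ) (hstar : IsProfile pstar)
    (hlim : ∀ i (a : S i), Tendsto (fun k => p k i a) atTop (nhds (pstar i a))) :
    IsNash u pstar := by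
  refine hstar.isNash_of_support fun i a b hab => ?_
  have h_zero := tendsto_div_rpow_zero (tendsto_actionPayoff u hlim i a)
    (tendsto_actionPayoff u hlim i b) hα (hstar.actionPayoff_pos hu i a) hab
  exact le_antisymm
    (le_of_tendsto_of_tendsto' (hlim i a) h_zero fun k => (hp k).le_div_rpow hu i a b)
    (hstar.1 i a)
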